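/- arXiv:1312.6354 — 3 statements merged into one kernel-verified Lean document; each statement's English description precedes it below -/
import Mathlib

section
/- For all real numbers a and b, ∫_{−∞}^{∞} Φ(az+b) φ(z) dz = Φ(b/√(1+a²)). -/
open Real

/-- The standard normal density `φ(x) = (2π)^{-1/2} exp(-x²/2)`. -/
noncomputable def stdPdf (x : ℝ) : ℝ := (2 * π) ^ (-(1 / 2 : ℝ)) * Real.exp (-x ^ 2 / 2)

/-- The standard normal distribution function `Φ(x) = ∫_{-∞}^x φ(t) dt`. -/
noncomputable def stdCdf (x : ℝ) : ℝ := ∫ t in Set.Iic x, stdPdf t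

open MeasureTheory ProbabilityTheory

lemma stdPdf_eq_gaussianPDFReal (x : ℝ) : stdPdf x = gaussianPDFReal 0 1 x := by
  rw [stdPdf, gaussianPDFReal_def, Real.sqrt_eq_rpow, Real.rpow_neg (by positivity)]
  simp

lemma stdCdf_eq_measureReal_Iic (x : ℝ) : stdCdf x = (gaussianReal 0 1).real (Set.Iic x) := by
  have h : 0 ≤ ∫ t in Set.Iic x, gaussianPDFReal 0 1 t :=
    integral_nonneg fun t ↦ gaussianPDFReal_nonneg 0 1 t
  rw [measureReal_def, gaussianReal_apply_eq_integral 0 one_ne_zero, ENNReal.toReal_ofReal h]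
  simp only [stdCdf, stdPdf_eq_gaussianPDFReal]

lemma lintegral_gaussianReal_Iic_affine (a b : ℝ) :
    ∫⁻ z, gaussianReal 0 1 (Set.Iic (a * z + b)) ∂(gaussianReal 0 1) =
      gaussianReal 0 1 (Set.Iic (b / √(1 + a ^ 2))) := by
  have hs : 0 < √(1 + a ^ 2) := by positivity
  have hconv : ((gaussianReal 0 1).map (-a * ·)) ∗ gaussianReal 0 1 =
      (gaussianReal 0 1).map (√(1 + a ^ 2) * ·) := by
    rw [gaussianReal_map_const_mul, gaussianReal_map_const_mul, gaussianReal_conv_gaussianReal]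
    congr 1
    · simp
    · ext
      simp [Real.sq_sqrt (by positivity : (0 : ℝ) ≤ a ^ 2 + 1), add_comm (1 : ℝ)]
  have h := congrArg (fun μ : Measure ℝ ↦ μ (Set.Iic b)) hconv
  rw [Measure.conv, Measure.map_apply (by fun_prop) measurableSet_Iic,
    Measure.prod_apply (measurableSet_Iic.preimage (by fun_prop)),
    lintegral_map (measurable_measure_prodMk_left (measurableSet_Iic.preimage (by fun_prop)))
      (by fun_prop),
    Measure.map_apply (by fun_prop) measurableSet_Iic] at h
  convert h using 2
  · ext z
    congr 1
    ext y
    simp only [Set.mem_Iic, Set.mem_preimage]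
    constructor <;> intro _ <;> linarith
  · ext y
    simp [le_div_iff₀ hs, mul_comm]

/-- `∫ Φ(az+b) φ(z) dz = Φ(b/√(1+a²))`. -/
theorem integral_cdf_mul_pdf (a b : ℝ) :
    ∫ z : ℝ, stdCdf (a * z + b) * stdPdf z = stdCdf (b / Real.sqrt (1 + a ^ 2)) := by
  have hmeas : Measurable fun z : ℝ ↦ gaussianReal 0 1 (Set.Iic (a * z + b)) :=
    (Monotone.measurable fun _ _ h ↦ measure_mono (Set.Iic_subset_Iic.2 h)).comp (by fun_prop)
  calc ∫ z : ℝ, stdCdf (a * z + b) * stdPdf z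
      = ∫ z, (gaussianReal 0 1).real (Set.Iic (a * z + b)) ∂(gaussianReal 0 1) := by
        rw [integral_gaussianReal_eq_integral_smul one_ne_zero]
        simp only [stdCdf_eq_measureReal_Iic, stdPdf_eq_gaussianPDFReal, smul_eq_mul, mul_comm]
    _ = (∫⁻ z, gaussianReal 0 1 (Set.Iic (a * z + b)) ∂(gaussianReal 0 1)).toReal :=
        integral_toReal hmeas.aemeasurable (by simp)
    _ = stdCdf (b / √(1 + a ^ 2)) := by
        rw [lintegral_gaussianReal_Iic_affine, stdCdf_eq_measureReal_Iic, measureReal_def]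
end

section
/- For all real numbers a and b, with c = b/√(1+a²), the Gaussian integral ∫_{−∞}^{∞} z³ · φ(az+b) φ(z) dz equals g₃ · φ(c), where g₃ = −ab(3 + a²(3+b²))(1+a²)^{-3} g₀ and g₀ = (1+a²)^{-1/2}. -/
open Real

theorem integrable_pow_mul_exp_neg_mul_sq {s : ℝ} (hs : 0 < s) (k : ℕ) :
    MeasureTheory.Integrable fun x : ℝ => x ^ k * Real.exp (-s * x ^ 2) := by
  have h : (-1 : ℝ) < k := by
    have := Nat.cast_nonneg (α := ℝ) k
    linarith
  simpa only [Real.rpow_natCast] using integrable_rpow_mul_exp_neg_mul_sq hs h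

/-- The third moment of an unnormalized Gaussian weight of precision `2 * s`, about `-m`. -/
theorem integral_add_pow_three_mul_exp_neg_mul_sq {s : ℝ} (hs : 0 < s) (m : ℝ) :
    ∫ x : ℝ, (x + m) ^ 3 * Real.exp (-s * x ^ 2) =
      (m ^ 3 + 3 * m / (2 * s)) * √(π / s) := by
  have hI := integrable_pow_mul_exp_neg_mul_sq hs
  have h0 := (hI 0).const_mul
  have h1 := (hI 1).const_mul
  have h2 := (hI 2).const_mul
  have h3 := hI 3
  set f : ℝ → ℝ := fun x =>
    (-1 / (2 * s) * x ^ 2 + -(3 * m) / (2 * s) * x + (-1 / s - 3 * m ^ 2) / (2 * s)) *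
      Real.exp (-s * x ^ 2) with hf
  set f' : ℝ → ℝ := fun x =>
    (x ^ 3 + 3 * m * x ^ 2 + 3 * m ^ 2 * x - 3 * m / (2 * s)) * Real.exp (-s * x ^ 2) with hf'
  have hderiv (x : ℝ) : HasDerivAt f (f' x) x := by
    have hx := hasDerivAt_id' x
    have hq := (((hx.pow 2).const_mul (-1 / (2 * s))).add
      (hx.const_mul (-(3 * m) / (2 * s)))).add_const ((-1 / s - 3 * m ^ 2) / (2 * s))
    have he := ((hx.pow 2).const_mul (-s)).exp
    refine (hq.mul he).congr_deriv ?_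
    simp only [hf', Pi.add_apply, Pi.pow_apply]
    field_simp
    ring
  have hfi : MeasureTheory.Integrable f := by
    refine (((h2 (-1 / (2 * s))).add (h1 (-(3 * m) / (2 * s)))).add
      (h0 ((-1 / s - 3 * m ^ 2) / (2 * s)))).congr (.of_forall fun x => ?_)
    simp only [hf, Pi.add_apply]
    ring
  have hfi' : MeasureTheory.Integrable f' := by
    refine (((h3.add (h2 (3 * m))).add (h1 (3 * m ^ 2))).add
      (h0 (-(3 * m / (2 * s))))).congr (.of_forall fun x => ?_)
    simp only [hf', Pi.add_apply]
    ring
  have hzero := MeasureTheory.integral_eq_zero_of_hasDerivAt_of_integrable hderiv hfi' hfi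
  have hsplit (x : ℝ) : (x + m) ^ 3 * Real.exp (-s * x ^ 2) =
      f' x + (m ^ 3 + 3 * m / (2 * s)) * Real.exp (-s * x ^ 2) := by
    simp only [hf']
    ring
  simp_rw [hsplit]
  rw [MeasureTheory.integral_add hfi' ((integrable_exp_neg_mul_sq hs).const_mul _), hzero,
    MeasureTheory.integral_const_mul, integral_gaussian, zero_add]

/-- `∫ z³ φ(az+b) φ(z) dz = g₃ · φ(c)` with `c = b/√(1+a²)`,
`g₃ = −ab(3 + a²(3+b²))(1+a²)^{-3} g₀`, `g₀ = (1+a²)^{-1/2}`. -/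
theorem gaussian_integral_g3 (a b : ℝ) :
    ∫ z : ℝ, z ^ 3 * (stdPdf (a * z + b) * stdPdf z) =
      (-(a * b) * (3 + a ^ 2 * (3 + b ^ 2)) * ((1 + a ^ 2)⁻¹) ^ 3 *
          (1 + a ^ 2) ^ (-(1 / 2 : ℝ))) *
        stdPdf (b / Real.sqrt (1 + a ^ 2)) := by
  have hs : 0 < 1 + a ^ 2 := by positivity
  have hc : (b / √(1 + a ^ 2)) ^ 2 = b ^ 2 / (1 + a ^ 2) := by
    rw [div_pow, Real.sq_sqrt hs.le]
  rw [← MeasureTheory.integral_add_right_eq_self _ (-(a * b) / (1 + a ^ 2))]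
  have hprod (x : ℝ) :
      (x + -(a * b) / (1 + a ^ 2)) ^ 3 * (stdPdf (a * (x + -(a * b) / (1 + a ^ 2)) + b) *
        stdPdf (x + -(a * b) / (1 + a ^ 2))) =
      ((2 * π) ^ (-(1 / 2 : ℝ)) * stdPdf (b / √(1 + a ^ 2))) *
        ((x + -(a * b) / (1 + a ^ 2)) ^ 3 * Real.exp (-((1 + a ^ 2) / 2) * x ^ 2)) := by
    have hexp : Real.exp (-(a * (x + -(a * b) / (1 + a ^ 2)) + b) ^ 2 / 2) *
        Real.exp (-(x + -(a * b) / (1 + a ^ 2)) ^ 2 / 2) =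
        Real.exp (-(b ^ 2 / (1 + a ^ 2)) / 2) * Real.exp (-((1 + a ^ 2) / 2) * x ^ 2) := by
      rw [← Real.exp_add, ← Real.exp_add]
      congr 1
      field_simp
      ring
    simp only [stdPdf, hc]
    linear_combination ((2 * π) ^ (-(1 / 2 : ℝ))) ^ 2 * (x + -(a * b) / (1 + a ^ 2)) ^ 3 * hexp
  have hnorm : (2 * π) ^ (-(1 / 2 : ℝ)) * √(π / ((1 + a ^ 2) / 2)) =
      (1 + a ^ 2) ^ (-(1 / 2 : ℝ)) := by
    have hpi : 0 < 2 * π := by positivity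
    rw [show π / ((1 + a ^ 2) / 2) = 2 * π / (1 + a ^ 2) by field_simp,
      Real.rpow_neg hpi.le, Real.rpow_neg hs.le, ← Real.sqrt_eq_rpow, ← Real.sqrt_eq_rpow,
      Real.sqrt_div hpi.le]
    have := Real.sqrt_pos.2 hpi
    field_simp
  simp_rw [hprod]
  rw [MeasureTheory.integral_const_mul,
    integral_add_pow_three_mul_exp_neg_mul_sq (half_pos hs), ← hnorm]
  field_simp
  ring
end

section
/- Fix x ∈ ℝ. Then, as δ → 0, Φ^{-1}(Φ(x) + φ(x) δ) = x + δ + ½ x δ² + O(δ³); that is, the function δ ↦ Φ^{-1}(Φ(x) + φ(x)δ) − x − δ − ½ x δ² is O(δ³) as δ → 0. -/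
open Real Asymptotics

/-- The standard normal quantile function `Φ⁻¹`, the inverse of `Φ` (which is injective,
so `Function.invFun` is a genuine two-sided inverse on the range `(0,1)`). -/
noncomputable def stdQuantile : ℝ → ℝ := Function.invFun stdCdf

/-- If `f 0 = 0` and `f' = O(t ^ n)` near `0`, then `f = O(t ^ (n + 1))`. -/
theorem isBigO_pow_succ_of_hasDerivAt {f f' : ℝ → ℝ} {n : ℕ} (h0 : f 0 = 0)
    (hf : ∀ᶠ t in nhds 0, HasDerivAt f (f' t) t) (hO : f' =O[nhds 0] fun t : ℝ => t ^ n) :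
    f =O[nhds 0] fun t : ℝ => t ^ (n + 1) := by
  obtain ⟨C, hC, hb⟩ := hO.exists_nonneg
  obtain ⟨ε, hε, hball⟩ := Metric.eventually_nhds_iff_ball.1 (hf.and hb.bound)
  refine IsBigO.of_bound C ?_
  filter_upwards [Metric.ball_mem_nhds (0 : ℝ) hε] with t ht
  have hsub : ∀ s ∈ Metric.closedBall (0 : ℝ) |t|, s ∈ Metric.ball (0 : ℝ) ε := by
    intro s hs
    simp only [Metric.mem_closedBall, Metric.mem_ball, dist_zero_right, norm_eq_abs] at *
    linarith
  have key := (convex_closedBall (0 : ℝ) |t|).norm_image_sub_le_of_norm_hasDerivWithin_le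
    (C := C * |t| ^ n) (fun s hs => (hball s (hsub s hs)).1.hasDerivWithinAt)
    (fun s hs => (hball s (hsub s hs)).2.trans (by
      rw [norm_pow, norm_eq_abs]
      have : |s| ≤ |t| := by simpa using hs
      gcongr))
    (by simp : (0 : ℝ) ∈ Metric.closedBall (0 : ℝ) |t|)
    (by simp : t ∈ Metric.closedBall (0 : ℝ) |t|)
  simpa [h0, pow_succ, mul_assoc] using key

theorem stdPdf_pos (x : ℝ) : 0 < stdPdf x := by
  unfold stdPdf
  positivity

theorem hasDerivAt_stdPdf (x : ℝ) : HasDerivAt stdPdf (-x * stdPdf x) x := by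
  have h : HasDerivAt (fun y : ℝ => -y ^ 2 / 2) (-x) x := by
    convert! ((hasDerivAt_pow 2 x).neg.div_const 2) using 1
    simp
    ring
  convert! (h.exp.const_mul ((2 * π) ^ (-(1 / 2 : ℝ)))) using 1
  unfold stdPdf
  ring

theorem continuous_stdPdf : Continuous stdPdf :=
  continuous_iff_continuousAt.2 fun x => (hasDerivAt_stdPdf x).continuousAt

theorem integrable_stdPdf : MeasureTheory.Integrable stdPdf := by
  convert! (integrable_exp_neg_mul_sq (b := 1 / 2) (by norm_num)).const_mul
    ((2 * π) ^ (-(1 / 2 : ℝ))) using 1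
  ext x
  unfold stdPdf
  ring_nf

theorem hasStrictDerivAt_stdCdf (x : ℝ) : HasStrictDerivAt stdCdf (stdPdf x) x := by
  have h : stdCdf = fun y => stdCdf 0 + ∫ t in (0 : ℝ)..y, stdPdf t := by
    ext y
    rw [← intervalIntegral.integral_Iic_sub_Iic integrable_stdPdf.integrableOn
      integrable_stdPdf.integrableOn]
    simp [stdCdf]
  rw [h]
  exact (continuous_stdPdf.integral_hasStrictDerivAt 0 x).const_add _

theorem strictMono_stdCdf : StrictMono stdCdf :=
  strictMono_of_hasDerivAt_pos (fun x => (hasStrictDerivAt_stdCdf x).hasDerivAt) stdPdf_pos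

theorem stdQuantile_stdCdf (x : ℝ) : stdQuantile (stdCdf x) = x :=
  Function.leftInverse_invFun strictMono_stdCdf.injective x

theorem hasDerivAt_stdQuantile (x : ℝ) :
    HasDerivAt stdQuantile (stdPdf x)⁻¹ (stdCdf x) :=
  ((hasStrictDerivAt_stdCdf x).to_local_left_inverse (stdPdf_pos x).ne'
    (Filter.Eventually.of_forall stdQuantile_stdCdf)).hasDerivAt

theorem eventually_mem_range_stdCdf (x : ℝ) : ∀ᶠ y in nhds (stdCdf x), y ∈ Set.range stdCdf := by
  rw [← (hasStrictDerivAt_stdCdf x).map_nhds_eq (stdPdf_pos x).ne']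
  exact Filter.eventually_map.2 (Filter.Eventually.of_forall Set.mem_range_self)

/-- for fixed `x`, `Φ⁻¹(Φ(x) + φ(x)δ) = x + δ + ½xδ² + O(δ³)` as `δ → 0`. -/
theorem quantile_second_order_expansion (x : ℝ) :
    (fun δ : ℝ =>
        stdQuantile (stdCdf x + stdPdf x * δ) - x - δ - (1 / 2) * x * δ ^ 2)
      =O[nhds 0] fun δ : ℝ => δ ^ 3 := by
  set g : ℝ → ℝ := fun δ => stdQuantile (stdCdf x + stdPdf x * δ) with hg
  set h : ℝ → ℝ := fun δ => stdPdf x / stdPdf (g δ) with hh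
  have g0 : g 0 = x := by simp [hg, stdQuantile_stdCdf]
  have h0 : h 0 = 1 := by simp [hh, g0, (stdPdf_pos x).ne']
  have hlin (δ : ℝ) : HasDerivAt (fun δ => stdCdf x + stdPdf x * δ) (stdPdf x) δ := by
    simpa using ((hasDerivAt_id δ).const_mul (stdPdf x)).const_add (stdCdf x)
  have hg' : ∀ᶠ δ in nhds 0, HasDerivAt g (h δ) δ := by
    have hc : Filter.Tendsto (fun δ => stdCdf x + stdPdf x * δ) (nhds 0) (nhds (stdCdf x)) := by
      simpa using (hlin 0).continuousAt.tendsto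
    filter_upwards [hc.eventually (eventually_mem_range_stdCdf x)] with δ ⟨y, hy⟩
    have hgy : g δ = y := by rw [hg]; simp only [← hy, stdQuantile_stdCdf]
    have hd := hasDerivAt_stdQuantile y
    rw [hy] at hd
    convert! hd.comp δ (hlin δ) using 1
    rw [hh]
    simp only [hgy]
    ring
  have hh' : ∀ᶠ δ in nhds 0, HasDerivAt h (g δ * h δ ^ 2) δ := by
    filter_upwards [hg'] with δ hδ
    have hp := (stdPdf_pos (g δ)).ne'
    convert! (hasDerivAt_const δ (stdPdf x)).div ((hasDerivAt_stdPdf (g δ)).comp δ hδ) hp using 1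
    simp only [hh, Function.comp_apply]
    field_simp
    ring
  have e1 : (fun δ => g δ * h δ ^ 2 - x) =O[nhds 0] fun δ : ℝ => δ ^ 1 := by
    have hd := (hg'.self_of_nhds.mul (hh'.self_of_nhds.pow 2)).isBigO_sub
    simpa [g0, h0] using hd
  have e2 : (fun δ => h δ - 1 - x * δ) =O[nhds 0] fun δ : ℝ => δ ^ 2 := by
    refine isBigO_pow_succ_of_hasDerivAt (by simp [h0]) ?_ e1
    filter_upwards [hh'] with δ hδ
    convert! (hδ.sub_const 1).sub ((hasDerivAt_id δ).const_mul x) using 1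
    simp
  refine isBigO_pow_succ_of_hasDerivAt (by simp [stdQuantile_stdCdf]) ?_ e2
  filter_upwards [hg'] with δ hδ
  convert! ((hδ.sub_const x).sub (hasDerivAt_id δ)).sub
    ((hasDerivAt_pow 2 δ).const_mul ((1 / 2) * x)) using 1
  simp
  ring
end
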